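/- arXiv:1112.4250 — 3 statements merged into one kernel-verified Lean document; each statement's English description precedes it below -/
import Mathlib

section
/- If 𝒜 is a deterministic semi-flower automaton over a finite alphabet A, then Y_𝒜, the set of labels of cycles simple in 1, is the unique minimal set of generators of the submonoid L(𝒜) of A*; in particular rk(L(𝒜)) = |Y_𝒜|. -/
open Pointwise

/-- A finite automaton over an alphabet `A`, given by its finite set of states,
sets of initial and final states, and set of transitions. -/
structure FA (Q A : Type*) where
  states : Finset Q
  I : Finset Q
  T : Finset Q
  F : Finset (Q × A × Q)
  I_sub : I ⊆ states
  T_sub : T ⊆ states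
  F_src : ∀ t ∈ F, t.1 ∈ states
  F_tgt : ∀ t ∈ F, t.2.2 ∈ states

namespace FA

variable {Q Q' A : Type*}

/-- `M.IsPath p ts q` : `ts` is a (possibly null) path of consecutive transitions
from `p` to `q` in `M`. -/
def IsPath (M : FA Q A) : Q → List (Q × A × Q) → Q → Prop
  | p, [], q => p = q
  | p, t :: ts, q => t ∈ M.F ∧ t.1 = p ∧ M.IsPath t.2.2 ts q

/-- The label of a path, as an element of the free monoid `A*`. -/
def label (ts : List (Q × A × Q)) : FreeMonoid A :=
  FreeMonoid.ofList (ts.map fun t => t.2.1)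

/-- The states visited by a path starting at `p`. -/
def statesOf (p : Q) (ts : List (Q × A × Q)) : List Q :=
  p :: ts.map fun t => t.2.2

/-- A state is accessible if some path leads from an initial state to it. -/
def Accessible (M : FA Q A) (q : Q) : Prop := ∃ i ∈ M.I, ∃ ts, M.IsPath i ts q

/-- A state is coaccessible if some path leads from it to a final state. -/
def Coaccessible (M : FA Q A) (q : Q) : Prop := ∃ t ∈ M.T, ∃ ts, M.IsPath q ts t

/-- An automaton is trim if every state is accessible and coaccessible. -/
def Trim (M : FA Q A) : Prop := ∀ q ∈ M.states, M.Accessible q ∧ M.Coaccessible q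

/-- Deterministic: a unique initial state, and at most one transition per state and letter. -/
def Deterministic (M : FA Q A) : Prop :=
  M.I.card = 1 ∧ ∀ p a q q', (p, a, q) ∈ M.F → (p, a, q') ∈ M.F → q = q'

/-- The language accepted by `M`: labels of paths from an initial to a final state. -/
def lang (M : FA Q A) : Set (FreeMonoid A) :=
  { w | ∃ i ∈ M.I, ∃ t ∈ M.T, ∃ ts, M.IsPath i ts t ∧ label ts = w }

/-- A semi-flower automaton: trim, with unique initial state equal to the unique
final state `one`, and every cycle (non-null path from a state to itself) visits `one`. -/
structure IsSemiFlower (M : FA Q A) (one : Q) : Prop where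
  mem : one ∈ M.states
  init : M.I = {one}
  final : M.T = {one}
  trim : M.Trim
  cyc : ∀ q ts, ts ≠ [] → M.IsPath q ts q → one ∈ statesOf q ts

/-- A cycle simple in `one` : a cycle from `one` to `one` with no intermediate visit to `one`. -/
def SimpleCycleIn (M : FA Q A) (one : Q) (ts : List (Q × A × Q)) : Prop :=
  ts ≠ [] ∧ M.IsPath one ts one ∧ ∀ t ∈ ts.dropLast, t.2.2 ≠ one

/-- `Y_𝒜` : the set of labels of cycles simple in `one`. -/
def Y (M : FA Q A) (one : Q) : Set (FreeMonoid A) :=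
  { w | ∃ ts, M.SimpleCycleIn one ts ∧ label ts = w }

/-- `C_𝒜` : the set of cycles simple in `one`. -/
def C (M : FA Q A) (one : Q) : Set (List (Q × A × Q)) :=
  { ts | M.SimpleCycleIn one ts }

/-- The distance from `p` to `q` : the length of a shortest path from `p` to `q`. -/
noncomputable def dist (M : FA Q A) (p q : Q) : ℕ :=
  sInf { n | ∃ ts, M.IsPath p ts q ∧ ts.length = n }

section Deg

variable [DecidableEq Q] [DecidableEq A]

/-- The indegree of a state: the number of transitions ending at it. -/
def indeg (M : FA Q A) (q : Q) : ℕ := (M.F.filter fun t => t.2.2 = q).card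

/-- The outdegree of a state: the number of transitions starting at it. -/
def outdeg (M : FA Q A) (q : Q) : ℕ := (M.F.filter fun t => t.1 = q).card

/-- A branch point going in (bpi): a state of indegree at least 2. -/
def IsBpi (M : FA Q A) (q : Q) : Prop := 2 ≤ M.indeg q

/-- `BPO_i(𝒜)` : the set of states of outdegree exactly `i`. -/
def BPO (M : FA Q A) (i : ℕ) : Finset Q := M.states.filter fun q => M.outdeg q = i

end Deg

/-- The product automaton. -/
def prod [DecidableEq Q] [DecidableEq Q'] [DecidableEq A]
    (M : FA Q A) (N : FA Q' A) : FA (Q × Q') A where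
  states := M.states ×ˢ N.states
  I := M.I ×ˢ N.I
  T := M.T ×ˢ N.T
  F := ((M.F ×ˢ N.F).filter fun t => t.1.2.1 = t.2.2.1).image
        fun t => ((t.1.1, t.2.1), t.1.2.1, (t.1.2.2, t.2.2.2))
  I_sub := Finset.product_subset_product M.I_sub N.I_sub
  T_sub := Finset.product_subset_product M.T_sub N.T_sub
  F_src := by
    intro t ht
    simp only [Finset.mem_image, Finset.mem_filter, Finset.mem_product] at ht
    obtain ⟨s, ⟨⟨h1, h2⟩, -⟩, rfl⟩ := ht
    exact Finset.mem_product.mpr ⟨M.F_src _ h1, N.F_src _ h2⟩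
  F_tgt := by
    intro t ht
    simp only [Finset.mem_image, Finset.mem_filter, Finset.mem_product] at ht
    obtain ⟨s, ⟨⟨h1, h2⟩, -⟩, rfl⟩ := ht
    exact Finset.mem_product.mpr ⟨M.F_tgt _ h1, N.F_tgt _ h2⟩

open Classical in
/-- The trim part of an automaton: the restriction to states that are both
accessible and coaccessible. -/
noncomputable def trimPart (M : FA Q A) : FA Q A where
  states := M.states.filter fun q => M.Accessible q ∧ M.Coaccessible q
  I := M.I.filter fun q => M.Accessible q ∧ M.Coaccessible q
  T := M.T.filter fun q => M.Accessible q ∧ M.Coaccessible q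
  F := M.F.filter fun t => (M.Accessible t.1 ∧ M.Coaccessible t.1) ∧
        (M.Accessible t.2.2 ∧ M.Coaccessible t.2.2)
  I_sub := by
    intro q hq
    simp only [Finset.mem_filter] at *
    exact ⟨M.I_sub hq.1, hq.2⟩
  T_sub := by
    intro q hq
    simp only [Finset.mem_filter] at *
    exact ⟨M.T_sub hq.1, hq.2⟩
  F_src := by
    intro t ht
    simp only [Finset.mem_filter] at *
    exact ⟨M.F_src _ ht.1, ht.2.1⟩
  F_tgt := by
    intro t ht
    simp only [Finset.mem_filter] at *
    exact ⟨M.F_tgt _ ht.1, ht.2.2⟩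

end FA

/-- The minimal generating set of a submonoid `L` of a free monoid:
`(L ∖ {1}) ∖ (L ∖ {1})·(L ∖ {1})`. -/
def minGen {A : Type*} (L : Set (FreeMonoid A)) : Set (FreeMonoid A) :=
  (L \ {1}) \ ((L \ {1}) * (L \ {1}))

/-- The rank of a submonoid of a free monoid: the cardinality of its (unique)
minimal set of generators. -/
noncomputable def rkL {A : Type*} (L : Set (FreeMonoid A)) : ℕ := (minGen L).ncard

/-- The reduced rank `max (0, rk - 1)` of a submonoid of a free monoid. -/
noncomputable def rrk {A : Type*} (L : Set (FreeMonoid A)) : ℕ := rkL L - 1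

section MinGen

variable {A : Type*}

theorem minGen_closure_subset (S : Set (FreeMonoid A)) :
    minGen (Submonoid.closure S : Set (FreeMonoid A)) ⊆ S := by
  rintro w ⟨⟨hw, hw1⟩, hprod⟩
  have key : w ≠ 1 → w ∈ S ∨ w ∈ ((Submonoid.closure S : Set (FreeMonoid A)) \ {1}) *
      ((Submonoid.closure S : Set (FreeMonoid A)) \ {1}) := by
    clear hw1 hprod
    induction hw using Submonoid.closure_induction with
    | mem x hx => exact fun _ => Or.inl hx
    | one => exact fun h => absurd rfl h
    | mul x y hx hy ihx ihy =>
      intro hxy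
      by_cases h1 : x = 1
      · subst h1
        simpa using ihy (by simpa using hxy)
      by_cases h2 : y = 1
      · subst h2
        simpa using ihx (by simpa using hxy)
      exact Or.inr (Set.mul_mem_mul ⟨hx, h1⟩ ⟨hy, h2⟩)
  exact (key hw1).resolve_right hprod

theorem FreeMonoid.length_pos_of_ne_one {w : FreeMonoid A} (hw : w ≠ 1) : 0 < w.length :=
  Nat.pos_of_ne_zero (mt FreeMonoid.length_eq_zero.1 hw)

theorem closure_minGen (H : Submonoid (FreeMonoid A)) :
    Submonoid.closure (minGen (H : Set (FreeMonoid A))) = H := by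
  refine le_antisymm (Submonoid.closure_le.2 fun w hw => hw.1.1) fun w hw => ?_
  induction hn : w.length using Nat.strong_induction_on generalizing w with
  | _ n ih =>
    subst hn
    by_cases hw1 : w = 1
    · exact hw1 ▸ one_mem _
    by_cases hprod : w ∈ ((H : Set (FreeMonoid A)) \ {1}) * ((H : Set (FreeMonoid A)) \ {1})
    · obtain ⟨x, ⟨hx, hx1⟩, y, ⟨hy, hy1⟩, rfl⟩ := hprod
      have hxpos := FreeMonoid.length_pos_of_ne_one hx1
      have hypos := FreeMonoid.length_pos_of_ne_one hy1
      have hlen : (x * y).length = x.length + y.length := FreeMonoid.length_mul x y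
      exact mul_mem (ih _ (by simp only [hlen]; omega) x hx rfl)
        (ih _ (by simp only [hlen]; omega) y hy rfl)
    · exact Submonoid.subset_closure ⟨⟨hw, hw1⟩, hprod⟩

end MinGen

namespace FA

variable {Q A : Type*} {M : FA Q A} {one : Q}

theorem isPath_append {p q : Q} {ts us : List (Q × A × Q)} :
    M.IsPath p (ts ++ us) q ↔ ∃ r, M.IsPath p ts r ∧ M.IsPath r us q := by
  induction ts generalizing p with
  | nil => simp [IsPath]
  | cons t ts ih => simp [IsPath, ih, and_assoc]

theorem isPath_concat_target {p q : Q} {t : Q × A × Q} {ts : List (Q × A × Q)}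
    (h : M.IsPath p (ts ++ [t]) q) : t.2.2 = q := by
  obtain ⟨r, -, -, -, h⟩ := isPath_append.1 h
  exact h

theorem label_append (ts us : List (Q × A × Q)) :
    label (ts ++ us) = label ts * label us := by
  simp [label, FreeMonoid.ofList_append]

theorem label_eq_one {ts : List (Q × A × Q)} : label ts = 1 ↔ ts = [] := by
  rw [← FreeMonoid.length_eq_zero]
  exact List.length_eq_zero_iff.trans List.map_eq_nil_iff

/-- In a deterministic automaton a path is determined by its origin and its label. -/
theorem Deterministic.path_unique (hdet : M.Deterministic) {p q r : Q}
    {ts us : List (Q × A × Q)} (hts : M.IsPath p ts q) (hus : M.IsPath p us r)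
    (h : label ts = label us) : ts = us := by
  replace h : ts.map (fun t => t.2.1) = us.map fun t => t.2.1 := h
  induction ts generalizing p us with
  | nil => exact (List.map_eq_nil_iff.1 h.symm).symm
  | cons t ts ih =>
    cases us with
    | nil => simp at h
    | cons u us =>
      obtain ⟨p₁, a, q₁⟩ := t
      obtain ⟨p₂, b, q₂⟩ := u
      simp only [List.map_cons, List.cons.injEq] at h
      obtain ⟨hab, h⟩ := h
      obtain ⟨ht, rfl, hts⟩ := hts
      obtain ⟨hu, hp, hus⟩ := hus
      dsimp only at hab hp hts hus
      subst hab hp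
      obtain rfl := hdet.2 _ _ _ _ ht hu
      rw [ih hts hus h]

theorem IsSemiFlower.mem_lang (hsf : M.IsSemiFlower one) {w : FreeMonoid A} :
    w ∈ M.lang ↔ ∃ ts, M.IsPath one ts one ∧ label ts = w := by
  simp [lang, hsf.init, hsf.final]

/-- The language of a semi-flower automaton, as a submonoid. -/
def IsSemiFlower.langSubmonoid (hsf : M.IsSemiFlower one) : Submonoid (FreeMonoid A) where
  carrier := M.lang
  one_mem' := hsf.mem_lang.2 ⟨[], rfl, rfl⟩
  mul_mem' := by
    intro x y hx hy
    obtain ⟨ts, hts, rfl⟩ := hsf.mem_lang.1 hx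
    obtain ⟨us, hus, rfl⟩ := hsf.mem_lang.1 hy
    exact hsf.mem_lang.2 ⟨ts ++ us, isPath_append.2 ⟨one, hts, hus⟩, label_append ts us⟩

/-- A nonnull cycle at `one` is simple in `one` iff it is not a concatenation of two
nonnull cycles at `one`. -/
theorem simpleCycleIn_iff {ts : List (Q × A × Q)} (hne : ts ≠ [])
    (hts : M.IsPath one ts one) :
    M.SimpleCycleIn one ts ↔ ∀ us vs, us ≠ [] → vs ≠ [] → M.IsPath one us one →
      M.IsPath one vs one → us ++ vs ≠ ts := by
  constructor
  · rintro ⟨-, -, hsimple⟩ us vs hus hvs hpus - rfl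
    obtain ⟨us', t, rfl⟩ := List.eq_nil_or_concat' us |>.resolve_left hus
    rw [List.dropLast_append_of_ne_nil hvs] at hsimple
    exact hsimple t (by simp) (isPath_concat_target hpus)
  · refine fun h => ⟨hne, hts, fun t ht htone => ?_⟩
    obtain ⟨a, b, hab⟩ := List.append_of_mem ht
    have hsplit : (a ++ [t]) ++ (b ++ [ts.getLast hne]) = ts := by
      conv_rhs => rw [← List.dropLast_append_getLast hne, hab]
      simp
    obtain ⟨r, hr, hr'⟩ := isPath_append.1 (hsplit ▸ hts)
    obtain rfl : one = r := htone.symm.trans (isPath_concat_target hr)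
    exact h _ _ (by simp) (by simp) hr hr' hsplit

theorem Y_eq_minGen_lang (hdet : M.Deterministic) (hsf : M.IsSemiFlower one) :
    M.Y one = minGen M.lang := by
  ext w
  constructor
  · rintro ⟨ts, hts, rfl⟩
    refine ⟨⟨hsf.mem_lang.2 ⟨ts, hts.2.1, rfl⟩, mt label_eq_one.1 hts.1⟩, ?_⟩
    rintro ⟨x, ⟨hx, hx1⟩, y, ⟨hy, hy1⟩, hxy⟩
    obtain ⟨us, hus, rfl⟩ := hsf.mem_lang.1 hx
    obtain ⟨vs, hvs, rfl⟩ := hsf.mem_lang.1 hy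
    exact (simpleCycleIn_iff hts.1 hts.2.1).1 hts us vs (mt label_eq_one.2 hx1)
      (mt label_eq_one.2 hy1) hus hvs (hdet.path_unique (isPath_append.2 ⟨one, hus, hvs⟩)
        hts.2.1 ((label_append us vs).trans hxy))
  · rintro ⟨⟨hw, hw1⟩, hprod⟩
    obtain ⟨ts, hts, rfl⟩ := hsf.mem_lang.1 hw
    refine ⟨ts, (simpleCycleIn_iff (mt label_eq_one.2 hw1) hts).2 ?_, rfl⟩
    rintro us vs hus hvs hpus hpvs rfl
    exact hprod ⟨label us, ⟨hsf.mem_lang.2 ⟨us, hpus, rfl⟩, mt label_eq_one.1 hus⟩,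
      label vs, ⟨hsf.mem_lang.2 ⟨vs, hpvs, rfl⟩, mt label_eq_one.1 hvs⟩,
      (label_append us vs).symm⟩

end FA

/-- if `M` is a deterministic semi-flower automaton over a finite alphabet,
then `Y_𝒜` is the unique minimal set of generators of the submonoid `L(𝒜)`;
in particular `rk(L(𝒜)) = |Y_𝒜|`. -/
theorem det_semiFlower_Y_minimal_generators
    {Q A : Type*} [Fintype A] (M : FA Q A) (one : Q)
    (hdet : M.Deterministic) (hsf : M.IsSemiFlower one) :
    (↑(Submonoid.closure (M.Y one)) = M.lang) ∧
      (∀ S : Set (FreeMonoid A), ↑(Submonoid.closure S) = M.lang → M.Y one ⊆ S) ∧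
      rkL M.lang = (M.Y one).ncard := by
  have hY := FA.Y_eq_minGen_lang hdet hsf
  refine ⟨?_, fun S hS => ?_, by rw [rkL, hY]⟩
  · rw [hY]
    exact congrArg SetLike.coe (closure_minGen hsf.langSubmonoid)
  · rw [hY, ← hS]
    exact minGen_closure_subset S
end

section
/- Let 𝒜 be a semi-flower automaton with exactly two bpi's p and q such that the distance from q to the initial-final state 1 is not more than the distance from p to 1. Then every cycle in 𝒜 visits q. -/
open Pointwise

namespace FA

variable {Q A : Type*} {M : FA Q A}

theorem isPath_append_s8 {x z : Q} {a b : List (Q × A × Q)} :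
    M.IsPath x (a ++ b) z ↔ ∃ y, M.IsPath x a y ∧ M.IsPath y b z := by
  induction a generalizing x with
  | nil => simp [IsPath]
  | cons t a ih => simp [IsPath, ih, and_assoc]

theorem IsPath.end_mem_statesOf {x z : Q} {ts : List (Q × A × Q)} (h : M.IsPath x ts z) :
    z ∈ statesOf x ts := by
  induction ts generalizing x with
  | nil => simp [statesOf, show x = z from h]
  | cons t ts ih => exact List.mem_cons_of_mem _ (ih h.2.2)

theorem IsPath.split_of_mem {x z : Q} {ts : List (Q × A × Q)} (h : M.IsPath x ts z)
    {t : Q × A × Q} (ht : t ∈ ts) :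
    ∃ a b, ts = a ++ t :: b ∧ M.IsPath x (a ++ [t]) t.2.2 ∧ M.IsPath t.2.2 b z := by
  obtain ⟨a, b, rfl⟩ := List.append_of_mem ht
  obtain ⟨y, ha, htF, rfl, hb⟩ := isPath_append_s8.1 h
  exact ⟨a, b, rfl, isPath_append_s8.2 ⟨_, ha, htF, rfl, rfl⟩, hb⟩

theorem dist_le_length {x z : Q} {ts : List (Q × A × Q)} (h : M.IsPath x ts z) :
    M.dist x z ≤ ts.length :=
  Nat.sInf_le ⟨ts, h, rfl⟩

theorem IsPath.exists_length_eq_dist {x z : Q} {ts : List (Q × A × Q)} (h : M.IsPath x ts z) :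
    ∃ us, M.IsPath x us z ∧ us.length = M.dist x z :=
  Nat.sInf_mem (s := {n | ∃ us, M.IsPath x us z ∧ us.length = n}) ⟨_, ts, h, rfl⟩

theorem IsPath.dist_lt_of_mem {x z : Q} {ts : List (Q × A × Q)} (h : M.IsPath x ts z)
    {t : Q × A × Q} (ht : t ∈ ts) : M.dist t.2.2 z < ts.length := by
  obtain ⟨a, b, rfl, -, hb⟩ := h.split_of_mem ht
  have := dist_le_length hb
  simp only [List.length_append, List.length_cons]
  omega

/-- A cycle at `x` followed by a path made of its own transitions can be iterated into
arbitrarily long paths. -/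
theorem IsPath.exists_long {x z : Q} {ts us : List (Q × A × Q)} (hts : ts ≠ [])
    (hc : M.IsPath x ts x) (hu : M.IsPath x us z) (hsub : us ⊆ ts) (n : ℕ) :
    ∃ vs, M.IsPath x vs z ∧ n ≤ vs.length ∧ vs ⊆ ts := by
  induction n with
  | zero => exact ⟨us, hu, Nat.zero_le _, hsub⟩
  | succ n ih =>
    obtain ⟨vs, hv, hn, hs⟩ := ih
    refine ⟨ts ++ vs, isPath_append_s8.2 ⟨x, hc, hv⟩, ?_,
      List.append_subset.2 ⟨List.Subset.refl _, hs⟩⟩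
    have := List.length_pos_iff.2 hts
    rw [List.length_append]
    omega

section Deg

variable [DecidableEq Q]

theorem eq_of_not_isBpi {s t : Q × A × Q} (hs : s ∈ M.F) (ht : t ∈ M.F)
    (h : s.2.2 = t.2.2) (hb : ¬ M.IsBpi t.2.2) : s = t := by
  have hcard : (M.F.filter fun u => u.2.2 = t.2.2).card ≤ 1 := by
    unfold IsBpi indeg at hb
    omega
  exact Finset.card_le_one.1 hcard s (by simp [hs, h]) t (by simp [ht])

theorem IsBpi.mem_states {x : Q} (h : M.IsBpi x) : x ∈ M.states := by
  obtain ⟨t, ht⟩ := Finset.card_pos.1 (Nat.lt_of_lt_of_le Nat.two_pos h)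
  rw [Finset.mem_filter] at ht
  exact ht.2 ▸ M.F_tgt t ht.1

/-- A path none of whose transitions ends at a bpi is a suffix of every path with the same
end that is at least as long. -/
theorem IsPath.isSuffix_of_not_isBpi {x y z : Q} {us vs : List (Q × A × Q)}
    (hu : M.IsPath x us z) (hv : M.IsPath y vs z) (hb : ∀ t ∈ us, ¬ M.IsBpi t.2.2)
    (hlen : us.length ≤ vs.length) : us <:+ vs := by
  induction us using List.reverseRecOn generalizing vs z with
  | nil => exact List.nil_suffix
  | append_singleton us t ih =>
    obtain rfl | ⟨vs, s, rfl⟩ := List.eq_nil_or_concat' vs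
    · simp at hlen
    obtain ⟨_, hu', htF, rfl, htz⟩ := isPath_append_s8.1 hu
    obtain ⟨_, hv', hsF, rfl, hsz⟩ := isPath_append_s8.1 hv
    have hts : s = t := eq_of_not_isBpi hsF htF (Eq.trans hsz (Eq.symm htz)) (hb t (by simp))
    subst hts
    have := ih hu' hv' (fun t ht => hb t (by simp [ht])) (by simpa using hlen)
    obtain ⟨l, rfl⟩ := this
    exact ⟨l, by simp⟩

end Deg

end FA

/-- in a semi-flower automaton with exactly two bpi's `p` and `q`, where the
distance from `q` to `1` is not more than that of `p`, every cycle visits `q`. -/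
theorem every_cycle_visits_q
    {Q A : Type*} [DecidableEq Q] [DecidableEq A]
    (M : FA Q A) (one p q : Q) (hsf : M.IsSemiFlower one)
    (hpq : p ≠ q) (hp : M.IsBpi p) (hq : M.IsBpi q)
    (honly : ∀ r, M.IsBpi r → r = p ∨ r = q)
    (hdist : M.dist q one ≤ M.dist p one) :
    ∀ r ts, ts ≠ [] → M.IsPath r ts r → q ∈ FA.statesOf r ts := by
  obtain ⟨o, ho, us₀, hus₀⟩ := (hsf.trim q hq.mem_states).2
  obtain rfl : o = one := by simpa [hsf.final] using ho
  obtain ⟨us, hus, hlen⟩ := hus₀.exists_length_eq_dist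
  have hb : ∀ t ∈ us, ¬ M.IsBpi t.2.2 := by
    intro t ht hbt
    have hlt := hus.dist_lt_of_mem ht
    rcases honly _ hbt with h | h <;> rw [h] at hlt <;> omega
  intro r ts hts hr
  obtain ⟨ws, hws, hsub⟩ : ∃ ws, M.IsPath r ws o ∧ ws ⊆ ts := by
    rcases List.mem_cons.1 (hsf.cyc r ts hts hr) with h | h
    · exact ⟨[], h.symm, List.nil_subset _⟩
    · obtain ⟨t, ht, rfl⟩ := List.mem_map.1 h
      obtain ⟨a, b, rfl, ha, -⟩ := hr.split_of_mem ht
      exact ⟨a ++ [t], ha, by intro; simp; tauto⟩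
  obtain ⟨vs, hvs, hle, hvsub⟩ := hr.exists_long hts hws hsub us.length
  obtain ⟨l, rfl⟩ := hus.isSuffix_of_not_isBpi hvs hb hle
  have key : q ∈ FA.statesOf r l := by
    obtain ⟨y, hl, hy⟩ := FA.isPath_append_s8.1 hvs
    have hyq : y = q := by
      cases us with
      | nil => exact Eq.trans hy (Eq.symm hus)
      | cons t us => exact hy.2.1.symm.trans hus.2.1
    exact hyq ▸ hl.end_mem_statesOf
  rcases List.mem_cons.1 key with h | h
  · exact h ▸ List.mem_cons_self
  · exact List.mem_cons_of_mem _ (List.map_subset _ (List.append_subset.1 hvsub).1 h)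
end

section
/- Let 𝒜 = (Q, 1, 1, F) be a semi-flower automaton with exactly two bpi's p and q, where the distance from q to 1 is not more than the distance from p to 1; let m be the indegree of p, and write the indegree of q as l + k where k is the number of transitions ending at q that do not lie on any path from p to q. Then |F| = m + l + k + |Q| − 2. -/
open Pointwise

namespace FA

/-- The end of a non-null path has positive indegree. -/
theorem IsPath.indeg_pos {Q A : Type*} [DecidableEq Q] (M : FA Q A) {r s : Q}
    {ts : List (Q × A × Q)} (h : M.IsPath r ts s) (hne : ts ≠ []) : 0 < M.indeg s := by
  induction ts generalizing r with
  | nil => exact absurd rfl hne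
  | cons t ts ih =>
    obtain ⟨ht, -, hts⟩ := h
    rcases ts with _ | ⟨u, us⟩
    · exact Finset.card_pos.mpr ⟨t, Finset.mem_filter.mpr ⟨ht, hts⟩⟩
    · exact ih hts (List.cons_ne_nil _ _)

/-- Distinct states connected by a path: the end of the path has positive indegree. -/
theorem IsPath.indeg_pos_of_ne {Q A : Type*} [DecidableEq Q] (M : FA Q A) {r s : Q}
    {ts : List (Q × A × Q)} (h : M.IsPath r ts s) (hne : r ≠ s) : 0 < M.indeg s := by
  refine IsPath.indeg_pos M h ?_
  rintro rfl
  exact hne h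

theorem card_F_eq_sum_indeg {Q A : Type*} [DecidableEq Q] (M : FA Q A) :
    M.F.card = ∑ r ∈ M.states, M.indeg r :=
  Finset.card_eq_sum_card_fiberwise M.F_tgt

theorem mem_states_of_indeg_pos {Q A : Type*} [DecidableEq Q] (M : FA Q A) {r : Q}
    (h : 0 < M.indeg r) : r ∈ M.states := by
  obtain ⟨t, ht⟩ := Finset.card_pos.mp h
  obtain ⟨htF, rfl⟩ := Finset.mem_filter.mp ht
  exact M.F_tgt t htF

/-- In a semi-flower automaton with at least two states, every state has positive indegree. -/
theorem IsSemiFlower.indeg_pos {Q A : Type*} [DecidableEq Q] {M : FA Q A} {one r s : Q}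
    (hsf : M.IsSemiFlower one) (hr : r ∈ M.states) (hs : s ∈ M.states) (hsr : s ≠ r) :
    0 < M.indeg r := by
  by_cases h : one = r
  · obtain ⟨-, f, hf, ts, hts⟩ := hsf.trim s hs
    rw [hsf.final, Finset.mem_singleton] at hf
    subst hf h
    exact IsPath.indeg_pos_of_ne M hts hsr
  · obtain ⟨⟨i, hi, ts, hts⟩, -⟩ := hsf.trim r hr
    rw [hsf.init, Finset.mem_singleton] at hi
    subst hi
    exact IsPath.indeg_pos_of_ne M hts h

end FA

open Classical in
/-- if `M` is a semi-flower automaton with exactly two bpi's `p` and `q`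
(with `q` not farther from `1` than `p`), `m` is the indegree of `p`, and the indegree of `q`
is `l + k` where `k` counts the transitions ending at `q` lying on no path from `p` to `q`,
then `|F| = m + l + k + |Q| - 2`. -/
theorem card_F_two_bpi
    {Q A : Type*} [DecidableEq Q] [DecidableEq A]
    (M : FA Q A) (one p q : Q) (hsf : M.IsSemiFlower one)
    (hpq : p ≠ q) (hp : M.IsBpi p) (hq : M.IsBpi q)
    (honly : ∀ r, M.IsBpi r → r = p ∨ r = q)
    (hdist : M.dist q one ≤ M.dist p one)
    (m l k : ℕ) (hm : m = M.indeg p)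
    (hk : k = (M.F.filter fun t => t.2.2 = q ∧ ∀ ts, M.IsPath p ts q → t ∉ ts).card)
    (hlk : M.indeg q = l + k) :
    M.F.card = m + l + k + M.states.card - 2 := by
  have hp2 : 2 ≤ M.indeg p := hp
  have hq2 : 2 ≤ M.indeg q := hq
  have hpS : p ∈ M.states := M.mem_states_of_indeg_pos (by omega)
  have hqS : q ∈ M.states.erase p :=
    Finset.mem_erase.mpr ⟨hpq.symm, M.mem_states_of_indeg_pos (by omega)⟩
  have hrest : ∑ r ∈ (M.states.erase p).erase q, M.indeg r
      = ((M.states.erase p).erase q).card := by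
    rw [Finset.card_eq_sum_ones]
    refine Finset.sum_congr rfl fun r hr => ?_
    simp only [Finset.mem_erase] at hr
    obtain ⟨hrq, hrp, hrS⟩ := hr
    have hpos := hsf.indeg_pos hrS hpS hrp.symm
    have hlt : ¬ 2 ≤ M.indeg r := fun h => (honly r h).elim hrp hrq
    omega
  have hsum := M.card_F_eq_sum_indeg
  rw [← Finset.add_sum_erase _ _ hpS, ← Finset.add_sum_erase _ _ hqS, hrest] at hsum
  have hcardp := Finset.card_erase_add_one hpS
  have hcardq := Finset.card_erase_add_one hqS
  omega
end
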